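/- arXiv:1608.02558 — 12 statements merged into one kernel-verified Lean document; each statement's English description precedes it below -/
import Mathlib

section
/- Let λ ∈ (0,1) and let f : ℝ → ℝ be differentiable. Suppose that for all real numbers a < b, the weighted mean value condition (f(b) - f(a))/(b - a) = f'(λa + (1-λ)b) holds. Then there exist real constants c₂, c₁, c₀ such that f(x) = c₂x² + c₁x + c₀ for all x; moreover, if λ ≠ 1/2, then c₂ = 0, so f is an affine function. -/
theorem weighted_mvt_implies_quadratic
    (lam : ℝ) (hlam : lam ∈ Set.Ioo (0 : ℝ) 1)
    (f : ℝ → ℝ) (hf : Differentiable ℝ f)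
    (hmvt : ∀ a b : ℝ, a < b →
      (f b - f a) / (b - a) = deriv f (lam * a + (1 - lam) * b)) :
    ∃ c₂ c₁ c₀ : ℝ, (∀ x : ℝ, f x = c₂ * x ^ 2 + c₁ * x + c₀) ∧
      (lam ≠ 1 / 2 → c₂ = 0) := by
  obtain ⟨h0, h1⟩ := hlam
  obtain ⟨g, hg⟩ : ∃ g, g = deriv f := ⟨_, rfl⟩
  have hfg : ∀ x, HasDerivAt f (g x) x := fun x => hg ▸ (hf x).hasDerivAt
  have key : ∀ x h : ℝ, 0 < h → f (x + lam * h) - f (x - (1 - lam) * h) - h * g x = 0 := by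
    intro x h hh
    have := hmvt (x - (1 - lam) * h) (x + lam * h) (by nlinarith)
    rw [← hg, show x + lam * h - (x - (1 - lam) * h) = h by ring,
      show lam * (x - (1 - lam) * h) + (1 - lam) * (x + lam * h) = x by ring,
      div_eq_iff hh.ne'] at this
    linarith
  have lin1 : ∀ x h : ℝ, HasDerivAt (fun h => x + lam * h) lam h := by
    intro x h
    simpa using ((hasDerivAt_id h).const_mul lam).const_add x
  have lin2 : ∀ x h : ℝ, HasDerivAt (fun h => x - (1 - lam) * h) (-(1 - lam)) h := by
    intro x h
    simpa using ((hasDerivAt_id h).const_mul (1 - lam)).const_sub x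
  have zero : ∀ (F : ℝ → ℝ) (d h : ℝ), (∀ t, 0 < t → F t = 0) → 0 < h →
      HasDerivAt F d h → d = 0 := by
    intro F d h hF hh hd
    refine hd.unique ((hasDerivAt_const h (0 : ℝ)).congr_of_eventuallyEq ?_)
    filter_upwards [lt_mem_nhds hh] with t ht using hF t ht
  obtain ⟨k, hgk⟩ : ∃ k : ℝ → ℝ, ∀ x, HasDerivAt g (k x) x := by
    refine ⟨fun x => g (x + lam) - g (x - (1 - lam)), fun x => ?_⟩
    have e : g = fun x => f (x + lam) - f (x - (1 - lam)) := by
      funext y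
      have := key y 1 one_pos
      simp only [mul_one, one_mul] at this
      linarith
    have := ((hfg (x + lam)).comp_add_const x lam).sub
      ((hfg (x - (1 - lam))).comp_sub_const x (1 - lam))
    exact this.congr_of_eventuallyEq (Filter.Eventually.of_forall fun y => congrFun e y)
  have key2 : ∀ x h : ℝ, 0 < h →
      g (x + lam * h) * lam - g (x - (1 - lam) * h) * (-(1 - lam)) - g x = 0 := by
    intro x h hh
    refine zero _ _ h (key x) hh ?_
    have a1 := (hfg (x + lam * h)).comp h (lin1 x h)
    have a2 := (hfg (x - (1 - lam) * h)).comp h (lin2 x h)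
    have a3 := (hasDerivAt_id h).mul_const (g x)
    rw [one_mul] at a3
    exact (a1.sub a2).sub a3
  have key3 : ∀ x h : ℝ, 0 < h →
      k (x + lam * h) * lam * lam - k (x - (1 - lam) * h) * (-(1 - lam)) * (-(1 - lam)) = 0 := by
    intro x h hh
    refine zero _ _ h (key2 x) hh ?_
    have a1 := ((hgk (x + lam * h)).comp h (lin1 x h)).mul_const lam
    have a2 := ((hgk (x - (1 - lam) * h)).comp h (lin2 x h)).mul_const (-(1 - lam))
    exact (a1.sub a2).sub_const (g x)
  have key4 : ∀ a b : ℝ, a < b → k b * lam ^ 2 = k a * (1 - lam) ^ 2 := by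
    intro a b hab
    have := key3 (lam * a + (1 - lam) * b) (b - a) (by linarith)
    rw [show lam * a + (1 - lam) * b + lam * (b - a) = b by ring,
      show lam * a + (1 - lam) * b - (1 - lam) * (b - a) = a by ring] at this
    linarith
  have hk : ∀ x, k x = k 0 := by
    intro x
    have e1 := key4 (min x 0 - 1) x (by linarith [min_le_left x 0])
    have e2 := key4 (min x 0 - 1) 0 (by linarith [min_le_right x 0])
    exact mul_right_cancel₀ (pow_ne_zero 2 h0.ne') (e1.trans e2.symm)
  have hgl : ∀ x, g x = k 0 * x + g 0 := by
    intro x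
    have hd : ∀ y, HasDerivAt (fun y => g y - k 0 * y) 0 y := by
      intro y
      have := (hgk y).sub ((hasDerivAt_id y).const_mul (k 0))
      rw [hk y, mul_one, sub_self] at this
      exact this
    have := is_const_of_deriv_eq_zero (fun y => (hd y).differentiableAt) (fun y => (hd y).deriv) x 0
    simp only [mul_zero, sub_zero] at this
    linarith
  refine ⟨k 0 / 2, g 0, f 0, fun x => ?_, fun hl => ?_⟩
  · have hd : ∀ y, HasDerivAt (fun y => f y - (k 0 / 2 * y ^ 2 + g 0 * y)) 0 y := by
      intro y
      have := (hfg y).sub (((hasDerivAt_pow 2 y).const_mul (k 0 / 2)).add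
        ((hasDerivAt_id y).const_mul (g 0)))
      refine this.congr_deriv ?_
      rw [hgl y]
      push_cast
      ring
    have := is_const_of_deriv_eq_zero (fun y => (hd y).differentiableAt) (fun y => (hd y).deriv) x 0
    simp only [mul_zero, sub_zero] at this
    norm_num at this
    linarith
  · have := key4 0 1 one_pos
    rw [hk 1] at this
    have h2 : k 0 * (2 * lam - 1) = 0 := by linarith
    rcases mul_eq_zero.1 h2 with h | h
    · rw [h, zero_div]
    · exact absurd (by linarith) hl
end

section
/- Let f : ℝ → ℝ be differentiable and suppose that for all real numbers a < b, (f(b) - f(a))/(b - a) = f'((a + b)/2), i.e., the midpoint of every interval is a mean value abscissa. Then f is a polynomial of degree at most 2: there exist real constants c₂, c₁, c₀ such that f(x) = c₂x² + c₁x + c₀ for all x. -/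
theorem midpoint_mvt_implies_quadratic
    (f : ℝ → ℝ) (hf : Differentiable ℝ f)
    (hmvt : ∀ a b : ℝ, a < b →
      (f b - f a) / (b - a) = deriv f ((a + b) / 2)) :
    ∃ c₂ c₁ c₀ : ℝ, ∀ x : ℝ, f x = c₂ * x ^ 2 + c₁ * x + c₀ := by
  have key : ∀ x h : ℝ, f (x + h) - f (x - h) = 2 * h * deriv f x := by
    intro x h
    rcases lt_trichotomy h 0 with h0 | h0 | h0
    · have := hmvt (x + h) (x - h) (by linarith)
      rw [div_eq_iff (by linarith), show (x + h + (x - h)) / 2 = x by ring] at this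
      linarith
    · subst h0; simp
    · have := hmvt (x - h) (x + h) (by linarith)
      rw [div_eq_iff (by linarith), show (x - h + (x + h)) / 2 = x by ring] at this
      linarith
  have hd : ∀ x, HasDerivAt f (deriv f x) x := fun x => (hf x).hasDerivAt
  have hx : ∀ h x : ℝ, HasDerivAt (fun x => f (x + h) - f (x - h))
      (deriv f (x + h) - deriv f (x - h)) x := fun h x =>
    ((hd (x + h)).comp_add_const x h).sub ((hd (x - h)).comp_sub_const x h)
  have hg : Differentiable ℝ (deriv f) := by
    have e : deriv f = fun x => (f (x + 1) - f (x - 1)) / 2 := by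
      funext x
      have := key x 1
      linarith
    rw [e]
    exact fun x => ((hx 1 x).div_const 2).differentiableAt
  have h1 : ∀ h, deriv f h - deriv f (-h) = 2 * h * deriv (deriv f) 0 := by
    intro h
    have a := hx h 0
    have b := ((hg 0).hasDerivAt).const_mul (2 * h)
    simp only [key] at a
    have := a.unique b
    simpa using this
  have h2 : ∀ h, deriv f h + deriv f (-h) = 2 * deriv f 0 := by
    intro h
    have a : HasDerivAt (fun h => f (0 + h) - f (0 - h)) (deriv f (0 + h) - -deriv f (0 - h)) h :=
      ((hd (0 + h)).comp_const_add 0 h).sub ((hd (0 - h)).comp_const_sub 0 h)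
    simp only [key] at a
    have b := ((hasDerivAt_id h).const_mul 2).mul_const (deriv f 0)
    have := a.unique b
    simpa using this
  refine ⟨deriv (deriv f) 0 / 2, deriv f 0, f 0, fun x => ?_⟩
  have k := key (x / 2) (x / 2)
  rw [add_halves, sub_self] at k
  have e : deriv f (x / 2) = deriv f 0 + x / 2 * deriv (deriv f) 0 := by
    linarith [h1 (x / 2), h2 (x / 2)]
  rw [e] at k
  linear_combination k
end

section
/- Let λ ∈ (0,1) with λ ≠ 1/2, and let f : ℝ → ℝ be differentiable. Suppose that for all real numbers a < b, (f(b) - f(a))/(b - a) = f'(λa + (1-λ)b). Then f is affine: there exist real constants m and c such that f(x) = mx + c for all x. -/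
theorem weighted_mvt_implies_affine
    (lam : ℝ) (hlam : lam ∈ Set.Ioo (0 : ℝ) 1) (hlam' : lam ≠ 1 / 2)
    (f : ℝ → ℝ) (hf : Differentiable ℝ f)
    (hmvt : ∀ a b : ℝ, a < b →
      (f b - f a) / (b - a) = deriv f (lam * a + (1 - lam) * b)) :
    ∃ m c : ℝ, ∀ x : ℝ, f x = m * x + c := by
  obtain ⟨h0, h1⟩ := hlam
  obtain ⟨g, hg⟩ : ∃ g, g = deriv f := ⟨_, rfl⟩
  have hfd : ∀ x, HasDerivAt f (g x) x := fun x => hg ▸ (hf x).hasDerivAt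
  obtain ⟨mu, hmu⟩ : ∃ mu, mu = 1 - lam := ⟨_, rfl⟩
  have hmu0 : 0 < mu := by linarith
  -- the basic identity, with lam * a + mu * b = x
  have key : ∀ x h : ℝ, 0 < h → f (x + mu * 0 + lam * h) - f (x + (-mu) * h) = h * g x := by
    intro x h hh
    have := hmvt (x + (-mu) * h) (x + mu * 0 + lam * h) (by nlinarith)
    rw [← hg] at this
    have e1 : lam * (x + (-mu) * h) + (1 - lam) * (x + mu * 0 + lam * h) = x := by
      rw [hmu]; ring
    have e2 : x + mu * 0 + lam * h - (x + (-mu) * h) = h := by rw [hmu]; ring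
    rw [e1, e2, div_eq_iff hh.ne'] at this
    linarith
  simp only [mul_zero, add_zero] at key
  have lin : ∀ x c h : ℝ, HasDerivAt (fun h => x + c * h) c h := fun x c h => by
    simpa using ((hasDerivAt_id h).const_mul c).const_add x
  have hgd : Differentiable ℝ g := by
    have : g = fun x => f (x + lam * 1) - f (x + (-mu) * 1) := by
      funext x; rw [key x 1 one_pos, one_mul]
    rw [this]
    fun_prop
  have hgd' : ∀ x, HasDerivAt g (deriv g x) x := fun x => (hgd x).hasDerivAt
  have k1 : ∀ x h : ℝ, 0 < h → g (x + lam * h) * lam - g (x + (-mu) * h) * (-mu) = g x := by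
    intro x h hh
    have A := ((hfd (x + lam * h)).comp h (lin x lam h)).sub
      ((hfd (x + (-mu) * h)).comp h (lin x (-mu) h))
    have B : HasDerivAt (fun h => h * g x) (g x) h := by
      simpa using (hasDerivAt_id h).mul_const (g x)
    refine A.unique (B.congr_of_eventuallyEq ?_)
    filter_upwards [lt_mem_nhds hh] with t ht
    exact key x t ht
  have k2 : ∀ x h : ℝ, 0 < h →
      deriv g (x + lam * h) * lam * lam - deriv g (x + (-mu) * h) * (-mu) * (-mu) = 0 := by
    intro x h hh
    have A := (((hgd' (x + lam * h)).comp h (lin x lam h)).mul_const lam).sub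
      (((hgd' (x + (-mu) * h)).comp h (lin x (-mu) h)).mul_const (-mu))
    refine A.unique ((hasDerivAt_const h (g x)).congr_of_eventuallyEq ?_)
    filter_upwards [lt_mem_nhds hh] with t ht
    exact k1 x t ht
  have k3 : ∀ x h : ℝ, 0 < h →
      deriv g (x + lam * h) * lam - deriv g (x + (-mu) * h) * (-mu) = deriv g x := by
    intro x h hh
    have A := (((hgd' (x + lam * h)).comp_add_const x (lam * h)).mul_const lam).sub
      (((hgd' (x + (-mu) * h)).comp_add_const x ((-mu) * h)).mul_const (-mu))
    refine A.unique ((hgd' x).congr_of_eventuallyEq ?_)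
    filter_upwards with t
    exact k1 t h hh
  have k4 : ∀ x t : ℝ, 0 < t → lam * deriv g x = mu * deriv g (x - t) := by
    intro x t ht
    have a2 := k2 x (t / mu) (by positivity)
    have a3 := k3 x (t / mu) (by positivity)
    have e : x + (-mu) * (t / mu) = x - t := by field_simp; ring
    rw [e] at a2 a3
    rw [hmu] at a2 a3 ⊢
    linear_combination (-lam) * a3 + a2
  have k5 : ∀ x, deriv g x = 0 := by
    intro x
    have a := k4 (x + 2) 1 one_pos
    have b := k4 (x + 2) 2 two_pos
    have c := k4 (x + 1) 1 one_pos
    rw [show x + 2 - 1 = x + 1 by ring] at a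
    rw [show x + 2 - 2 = x by ring] at b
    rw [show x + 1 - 1 = x by ring] at c
    have d : mu * (lam - mu) * deriv g x = 0 := by
      linear_combination lam * a - lam * b + mu * c
    have hne : mu * (lam - mu) ≠ 0 := by
      refine mul_ne_zero hmu0.ne' fun h => hlam' ?_
      linarith
    exact (mul_eq_zero.mp d).resolve_left hne
  have k6 : ∀ x, g x = g 0 := fun x => is_const_of_deriv_eq_zero hgd k5 x 0
  refine ⟨g 0, f 0, fun x => ?_⟩
  have hd : ∀ y, HasDerivAt (fun y => f y - g 0 * y) 0 y := by
    intro y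
    have := (hfd y).sub ((hasDerivAt_id y).const_mul (g 0))
    rw [k6 y, mul_one, sub_self] at this
    exact this
  have := is_const_of_deriv_eq_zero (fun y => (hd y).differentiableAt) (fun y => (hd y).deriv) x 0
  simp only [mul_zero, sub_zero] at this
  linarith
end

section
/- Let f : ℝ → ℝ be three times continuously differentiable and suppose that for all real numbers a < b, (f(b) - f(a))/(b - a) = f'((a + b)/2). Then the third derivative of f vanishes identically: f'''(y) = 0 for all y ∈ ℝ. -/
theorem midpoint_mvt_third_deriv_zero
    (f : ℝ → ℝ) (hf : ContDiff ℝ 3 f)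
    (hmvt : ∀ a b : ℝ, a < b →
      (f b - f a) / (b - a) = deriv f ((a + b) / 2)) :
    ∀ y : ℝ, iteratedDeriv 3 f y = 0 := by
  have h0 : ∀ y h : ℝ, 0 < h → f (y + h) - f (y - h) = 2 * h * deriv f y := by
    intro y h hh
    have := hmvt (y - h) (y + h) (by linarith)
    rw [show (y - h + (y + h)) / 2 = y by ring, show y + h - (y - h) = 2 * h by ring,
      div_eq_iff (by positivity)] at this
    linarith
  have h1 : ∀ y h : ℝ, f (y + h) - f (y - h) = 2 * h * deriv f y := by
    intro y h
    rcases lt_trichotomy h 0 with hh | hh | hh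
    · have := h0 y (-h) (by linarith)
      rw [sub_neg_eq_add, ← sub_eq_add_neg] at this
      linarith
    · subst hh; simp
    · exact h0 y h hh
  have d1 : Differentiable ℝ f := hf.differentiable (by norm_num)
  have hf' : ContDiff ℝ 2 (deriv f) := by
    have : ContDiff ℝ (2 + 1) f := by
      rw [show (2 + 1 : WithTop ℕ∞) = 3 by norm_num]; exact hf
    exact (contDiff_succ_iff_deriv.1 this).2.2
  have d2 : Differentiable ℝ (deriv f) := hf'.differentiable (by norm_num)
  have h2 : ∀ y h : ℝ, deriv f (y + h) + deriv f (y - h) = 2 * deriv f y := by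
    intro y h
    have e1 := ((d1 (y + h)).hasDerivAt.comp_const_add y h).sub
      ((d1 (y - h)).hasDerivAt.comp_const_sub y h)
    have e2 : HasDerivAt (fun h => 2 * h * deriv f y) (2 * 1 * deriv f y) h :=
      ((hasDerivAt_id h).const_mul 2).mul_const _
    have e3 := e1.unique (e2.congr_of_eventuallyEq (Filter.Eventually.of_forall (h1 y)))
    linarith
  have h3 : ∀ y h : ℝ, deriv (deriv f) (y + h) = deriv (deriv f) (y - h) := by
    intro y h
    have e1 := ((d2 (y + h)).hasDerivAt.comp_const_add y h).add
      ((d2 (y - h)).hasDerivAt.comp_const_sub y h)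
    have e3 := e1.unique ((hasDerivAt_const h (2 * deriv f y)).congr_of_eventuallyEq
      (Filter.Eventually.of_forall (h2 y)))
    linarith
  have h4 : deriv (deriv f) = fun _ => deriv (deriv f) 0 := by
    funext u
    have := h3 (u / 2) (u / 2)
    simpa using this
  intro y
  rw [iteratedDeriv_succ, iteratedDeriv_succ, iteratedDeriv_one, h4]
  simp
end

section
/- Let λ ∈ (0,1) and let g : ℝ → ℝ be continuous. Suppose that for all x ∈ ℝ and all h > 0, g(x + (1-2λ)h) = (1/(2h)) ∫_{x-h}^{x+h} g(t) dt. Then g is infinitely differentiable (of class C^∞). -/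
theorem weighted_mean_value_property_implies_smooth
    (lam : ℝ) (hlam : lam ∈ Set.Ioo (0 : ℝ) 1)
    (g : ℝ → ℝ) (hg : Continuous g)
    (hmvp : ∀ x : ℝ, ∀ h : ℝ, 0 < h →
      g (x + (1 - 2 * lam) * h) = (1 / (2 * h)) * ∫ t in (x - h)..(x + h), g t) :
    ContDiff ℝ (⊤ : ℕ∞) g := by
  have hF : ∀ x, HasDerivAt (fun y => ∫ t in (0:ℝ)..y, g t) (g x) x := fun x =>
    intervalIntegral.integral_hasDerivAt_right (hg.intervalIntegrable _ _)
      (hg.stronglyMeasurableAtFilter _ _) hg.continuousAt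
  have hdF : deriv (fun y => ∫ t in (0:ℝ)..y, g t) = g := funext fun x => (hF x).deriv
  have key : g = fun y => (1 / 2 : ℝ) *
      ((fun y => ∫ t in (0:ℝ)..y, g t) (y - (1 - 2 * lam) + 1)
        - (fun y => ∫ t in (0:ℝ)..y, g t) (y - (1 - 2 * lam) - 1)) := by
    funext y
    have h1 := hmvp (y - (1 - 2 * lam)) 1 one_pos
    simp only [mul_one, sub_add_cancel] at h1
    rw [h1]
    simp only []
    rw [intervalIntegral.integral_interval_sub_left (hg.intervalIntegrable _ _)
      (hg.intervalIntegrable _ _)]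
  rw [contDiff_infty]
  intro n
  induction n with
  | zero => exact contDiff_zero.2 hg
  | succ n ih =>
    have hc : ContDiff ℝ ((n : ℕ) + 1) (fun y => ∫ t in (0:ℝ)..y, g t) := by
      rw [contDiff_succ_iff_deriv]
      refine ⟨fun x => (hF x).differentiableAt, by simp, ?_⟩
      rw [hdF]; exact ih
    rw [key]
    push_cast
    exact contDiff_const.mul ((hc.comp (by fun_prop : ContDiff ℝ _ fun y : ℝ => y - (1 - 2 * lam) + 1)).sub
      (hc.comp (by fun_prop : ContDiff ℝ _ fun y : ℝ => y - (1 - 2 * lam) - 1)))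
end

section
/- Let λ ∈ (0,1) and let g : ℝ → ℝ be continuously differentiable. Suppose that for all x ∈ ℝ and all h > 0, g(x + (1-2λ)h) = (1/(2h)) ∫_{x-h}^{x+h} g(t) dt. Then for every x ∈ ℝ and every h > 0, the derivative of g satisfies g'(x) = (1/(2h)) (g(x + 2λh) - g(x - (2 - 2λ)h)). -/
theorem weighted_mean_value_property_deriv_formula
    (lam : ℝ) (hlam : lam ∈ Set.Ioo (0 : ℝ) 1)
    (g : ℝ → ℝ) (hg : ContDiff ℝ 1 g)
    (hmvp : ∀ x : ℝ, ∀ h : ℝ, 0 < h →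
      g (x + (1 - 2 * lam) * h) = (1 / (2 * h)) * ∫ t in (x - h)..(x + h), g t) :
    ∀ x : ℝ, ∀ h : ℝ, 0 < h →
      deriv g x = (1 / (2 * h)) * (g (x + 2 * lam * h) - g (x - (2 - 2 * lam) * h)) := by
  intro x h hh
  have hc : Continuous g := hg.continuous
  have hF : ∀ z, HasDerivAt (fun u => ∫ t in (0 : ℝ)..u, g t) (g z) z := fun z =>
    intervalIntegral.integral_hasDerivAt_right (hc.intervalIntegrable _ _)
      (hc.stronglyMeasurableAtFilter _ _) hc.continuousAt
  have hEq : g = fun z => (1 / (2 * h)) * ((∫ t in (0 : ℝ)..(z + 2 * lam * h), g t)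
      - ∫ t in (0 : ℝ)..(z - (2 - 2 * lam) * h), g t) := by
    funext z
    have := hmvp (z - (1 - 2 * lam) * h) h hh
    rw [intervalIntegral.integral_interval_sub_left (hc.intervalIntegrable _ _)
      (hc.intervalIntegrable _ _)]
    rw [show z - (1 - 2 * lam) * h + (1 - 2 * lam) * h = z by ring,
      show z - (1 - 2 * lam) * h - h = z - (2 - 2 * lam) * h by ring,
      show z - (1 - 2 * lam) * h + h = z + 2 * lam * h by ring] at this
    exact this
  have h1 := (hF (x + 2 * lam * h)).comp_add_const x (2 * lam * h)
  have h2 := (hF (x - (2 - 2 * lam) * h)).comp_sub_const x ((2 - 2 * lam) * h)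
  have h3 := (h1.sub h2).const_mul (1 / (2 * h))
  have h4 : HasDerivAt g _ x := h3.congr_of_eventuallyEq
    (Filter.Eventually.of_forall fun z => congrFun hEq z)
  exact h4.deriv
end

section
/- Let λ ∈ (0,1) with λ ≠ 1/2, and let f : ℝ → ℝ be twice continuously differentiable. Suppose that for all real numbers a < b, (f(b) - f(a))/(b - a) = f'(λa + (1-λ)b). Then the second derivative of f vanishes identically: f''(y) = 0 for all y ∈ ℝ. -/
theorem weighted_mvt_second_deriv_zero
    (lam : ℝ) (hlam : lam ∈ Set.Ioo (0 : ℝ) 1) (hlam' : lam ≠ 1 / 2)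
    (f : ℝ → ℝ) (hf : ContDiff ℝ 2 f)
    (hmvt : ∀ a b : ℝ, a < b →
      (f b - f a) / (b - a) = deriv f (lam * a + (1 - lam) * b)) :
    ∀ y : ℝ, iteratedDeriv 2 f y = 0 := by
  intro y
  have hd : Differentiable ℝ f := hf.differentiable (by norm_num)
  have hd' : Differentiable ℝ (deriv f) := by
    have h := hf.differentiable_iteratedDeriv 1 (by norm_num)
    rwa [iteratedDeriv_one] at h
  rw [iteratedDeriv_succ, iteratedDeriv_one]
  have hl1 : ∀ h : ℝ, HasDerivAt (fun h : ℝ => y + lam * h) lam h := fun h => by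
    simpa using ((hasDerivAt_id h).const_mul lam).const_add y
  have hl2 : ∀ h : ℝ, HasDerivAt (fun h : ℝ => y - (1 - lam) * h) (-(1 - lam)) h := fun h => by
    simpa using ((hasDerivAt_id h).const_mul (1 - lam)).const_sub y
  have key : ∀ h : ℝ, 0 < h → f (y + lam * h) - f (y - (1 - lam) * h) = h * deriv f y := by
    intro h hh
    have h1 := hmvt (y - (1 - lam) * h) (y + lam * h) (by nlinarith)
    have e1 : y + lam * h - (y - (1 - lam) * h) = h := by ring
    have e2 : lam * (y - (1 - lam) * h) + (1 - lam) * (y + lam * h) = y := by ring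
    rw [e1, e2, div_eq_iff hh.ne'] at h1
    rw [h1, mul_comm]
  have key2 : ∀ h : ℝ, 0 ≤ h →
      deriv f (y + lam * h) * lam - deriv f (y - (1 - lam) * h) * (-(1 - lam)) = deriv f y := by
    intro h hh
    rcases hh.eq_or_lt with rfl | hh
    · simp only [mul_zero, add_zero, sub_zero]; ring
    · have A : HasDerivAt (fun h : ℝ => f (y + lam * h) - f (y - (1 - lam) * h))
          (deriv f (y + lam * h) * lam - deriv f (y - (1 - lam) * h) * (-(1 - lam))) h :=
        ((hd _).hasDerivAt.comp h (hl1 h)).sub ((hd _).hasDerivAt.comp h (hl2 h))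
      have B : HasDerivAt (fun h : ℝ => h * deriv f y) (deriv f y) h := by
        simpa using (hasDerivAt_id h).mul_const (deriv f y)
      refine A.unique (B.congr_of_eventuallyEq ?_)
      filter_upwards [lt_mem_nhds hh] with t ht using key t ht
  have A : HasDerivAt (fun h : ℝ => deriv f (y + lam * h) * lam
        - deriv f (y - (1 - lam) * h) * (-(1 - lam)))
      (deriv (deriv f) (y + lam * 0) * lam * lam
        - deriv (deriv f) (y - (1 - lam) * 0) * (-(1 - lam)) * (-(1 - lam))) 0 :=
    (((hd' _).hasDerivAt.comp 0 (hl1 0)).mul_const lam).sub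
      (((hd' _).hasDerivAt.comp 0 (hl2 0)).mul_const (-(1 - lam)))
  have B : HasDerivWithinAt (fun h : ℝ => deriv f (y + lam * h) * lam
        - deriv f (y - (1 - lam) * h) * (-(1 - lam))) 0 (Set.Ici 0) 0 :=
    (hasDerivWithinAt_const (0 : ℝ) (Set.Ici 0) (deriv f y)).congr
      (fun t ht => key2 t ht) (key2 0 le_rfl)
  have C := (uniqueDiffOn_Ici (0 : ℝ) 0 Set.self_mem_Ici).eq_deriv _ A.hasDerivWithinAt B
  simp only [mul_zero, add_zero, sub_zero] at C
  have D : (2 * lam - 1) * deriv (deriv f) y = 0 := by linear_combination C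
  rcases mul_eq_zero.mp D with h | h
  · exact absurd (by linarith) hlam'
  · exact h
end

section
/- Fix λ ∈ (0,1), a unit vector v ∈ ℝⁿ, and let g : ℝⁿ → ℝ be continuously differentiable. Suppose that for all x ∈ ℝⁿ and all h > 0, g(x + (1-2λ)h·v) = (1/|B_h(x)|) ∫_{B_h(x)} g(t) dV, where B_h(x) is the closed Euclidean ball of radius h centered at x and |B_h(x)| its Lebesgue volume. Then g is harmonic: g is twice continuously differentiable and its Laplacian Δg = Σᵢ ∂²g/∂xᵢ² vanishes identically. -/
open MeasureTheory Metric

theorem aux_int {n : ℕ} {f : EuclideanSpace ℝ (Fin n) → ℝ} (hf : Continuous f)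
    (r : ℝ) : IntegrableOn f (closedBall 0 r) :=
  hf.continuousOn.integrableOn_compact (isCompact_closedBall _ _)

theorem aux_deriv {n : ℕ} (g : EuclideanSpace ℝ (Fin n) → ℝ) (hg : ContDiff ℝ 1 g)
    (x : EuclideanSpace ℝ (Fin n)) (h : ℝ) :
    HasDerivAt (fun h : ℝ => ∫ y in closedBall (0 : EuclideanSpace ℝ (Fin n)) 1, g (x + h • y))
      (∫ y in closedBall (0 : EuclideanSpace ℝ (Fin n)) 1, fderiv ℝ g (x + h • y) y) h := by
  have hc : Continuous (fderiv ℝ g) := hg.continuous_fderiv (by norm_num)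
  have hgc := hg.continuous
  obtain ⟨C, hC⟩ := (isCompact_closedBall (0 : EuclideanSpace ℝ (Fin n))
    (‖x‖ + (|h| + 1))).exists_bound_of_continuousOn hc.continuousOn
  refine (hasDerivAt_integral_of_dominated_loc_of_deriv_le (s := ball h 1) (bound := fun _ => C)
    (F' := fun h y => fderiv ℝ g (x + h • y) y)
    (ball_mem_nhds h one_pos) ?_ ?_ ?_ ?_ ?_ ?_).2
  · exact .of_forall fun r => Continuous.aestronglyMeasurable (by fun_prop)
  · exact aux_int (by fun_prop) 1
  · exact Continuous.aestronglyMeasurable (by fun_prop)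
  · refine (ae_restrict_iff' measurableSet_closedBall).2 (.of_forall fun y hy r hr => ?_)
    simp only [mem_closedBall, dist_zero_right, mem_ball, Real.dist_eq] at hy hr
    have h1 : |r| ≤ |h| + 1 := by
      have := abs_sub_abs_le_abs_sub r h
      linarith
    have h2 : ‖fderiv ℝ g (x + r • y)‖ ≤ C := by
      apply hC
      simp only [mem_closedBall, dist_zero_right]
      refine (norm_add_le _ _).trans ?_
      rw [norm_smul, Real.norm_eq_abs]
      have : |r| * ‖y‖ ≤ |r| * 1 := by gcongr
      linarith
    refine (ContinuousLinearMap.le_opNorm _ _).trans ?_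
    have : ‖fderiv ℝ g (x + r • y)‖ * ‖y‖ ≤ ‖fderiv ℝ g (x + r • y)‖ * 1 := by gcongr
    linarith
  · exact aux_int continuous_const 1
  · refine .of_forall fun y r hr => ?_
    have h1 : HasDerivAt (fun r : ℝ => x + r • y) y r := by
      simpa using ((hasDerivAt_id r).smul_const y).const_add x
    exact ((hg.differentiable (by norm_num)) (x + r • y)).hasFDerivAt.comp_hasDerivAt r h1

theorem aux_iso {n : ℕ} (e : EuclideanSpace ℝ (Fin n) ≃ₗᵢ[ℝ] EuclideanSpace ℝ (Fin n))
    (f : EuclideanSpace ℝ (Fin n) → ℝ) (r : ℝ) :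
    ∫ y in closedBall (0 : EuclideanSpace ℝ (Fin n)) r, f (e y)
      = ∫ y in closedBall (0 : EuclideanSpace ℝ (Fin n)) r, f y := by
  have := e.measurePreserving.setIntegral_preimage_emb
    e.toHomeomorph.measurableEmbedding f (closedBall 0 r)
  rw [← this]
  congr 2
  ext y; simp

theorem aux_odd {n : ℕ} (L : EuclideanSpace ℝ (Fin n) →L[ℝ] ℝ) (r : ℝ) :
    ∫ y in closedBall (0 : EuclideanSpace ℝ (Fin n)) r, L y = 0 := by
  have := aux_iso (LinearIsometryEquiv.neg ℝ) L r
  simp only [LinearIsometryEquiv.coe_neg, map_neg, integral_neg] at this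
  linarith

theorem aux_offdiag {n : ℕ} (i j : Fin n) (hij : i ≠ j) :
    ∫ y in closedBall (0 : EuclideanSpace ℝ (Fin n)) 1, y i * y j = 0 := by
  have := aux_iso (LinearIsometryEquiv.piLpCongrRight 2
    (fun k => if k = i then LinearIsometryEquiv.neg ℝ else LinearIsometryEquiv.refl ℝ ℝ))
    (fun y => y i * y j) 1
  simp [hij.symm, integral_neg] at this
  linarith

theorem aux_diag {n : ℕ} (i j : Fin n) :
    ∫ y in closedBall (0 : EuclideanSpace ℝ (Fin n)) 1, y i * y i =
    ∫ y in closedBall (0 : EuclideanSpace ℝ (Fin n)) 1, y j * y j := by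
  have := aux_iso (LinearIsometryEquiv.piLpCongrLeft 2 ℝ ℝ (Equiv.swap i j))
    (fun y => y i * y i) 1
  rw [← this]
  simp [LinearIsometryEquiv.piLpCongrLeft_apply, Equiv.piCongrLeft']

theorem aux_diag_pos {n : ℕ} (i : Fin n) :
    0 < ∫ y in closedBall (0 : EuclideanSpace ℝ (Fin n)) 1, y i * y i := by
  have hc : Continuous fun y : EuclideanSpace ℝ (Fin n) => y i * y i := by fun_prop
  rw [setIntegral_pos_iff_support_of_nonneg_ae (.of_forall fun y => mul_self_nonneg _)
    (aux_int hc 1)]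
  have ho : IsOpen (Function.support (fun y : EuclideanSpace ℝ (Fin n) => y i * y i) ∩ ball 0 1) :=
    hc.isOpen_support.inter isOpen_ball
  refine lt_of_lt_of_le (ho.measure_pos volume ⟨EuclideanSpace.single i (1/2), ?_, ?_⟩)
    (measure_mono (Set.inter_subset_inter_right _ ball_subset_closedBall))
  · simp
  · simp; norm_num

theorem aux_trace {n : ℕ} (A : EuclideanSpace ℝ (Fin n) →L[ℝ] EuclideanSpace ℝ (Fin n) →L[ℝ] ℝ)
    (hA : ∫ y in closedBall (0 : EuclideanSpace ℝ (Fin n)) 1, A y y = 0) :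
    ∑ i, A (EuclideanSpace.single i 1) (EuclideanSpace.single i 1) = 0 := by
  have hexp : ∀ y : EuclideanSpace ℝ (Fin n), A y y = ∑ i, ∑ j, (y i * y j) *
      A (EuclideanSpace.single i 1) (EuclideanSpace.single j 1) := by
    intro y
    have hy : y = ∑ i, y i • EuclideanSpace.single i (1 : ℝ) := by
      have := (EuclideanSpace.basisFun (Fin n) ℝ).sum_repr y
      simpa using this.symm
    conv_lhs => rw [hy]
    simp only [map_sum, map_smul, sum_apply, smul_apply, smul_eq_mul, Finset.mul_sum]
    rw [Finset.sum_comm]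
    refine Finset.sum_congr rfl fun i _ => Finset.sum_congr rfl fun j _ => by ring
  simp_rw [hexp] at hA
  rw [integral_finsetSum _ fun i _ => aux_int (by fun_prop) 1] at hA
  have h2 : ∀ i : Fin n, ∫ y in closedBall (0 : EuclideanSpace ℝ (Fin n)) 1, ∑ j, (y i * y j) *
      A (EuclideanSpace.single i 1) (EuclideanSpace.single j 1) =
      (∫ y in closedBall (0 : EuclideanSpace ℝ (Fin n)) 1, y i * y i) *
        A (EuclideanSpace.single i 1) (EuclideanSpace.single i 1) := by
    intro i
    rw [integral_finsetSum _ fun i _ => aux_int (by fun_prop) 1]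
    rw [Finset.sum_eq_single i]
    · rw [integral_mul_const]
    · intro j _ hj
      rw [integral_mul_const, aux_offdiag i j hj.symm, zero_mul]
    · simp
  simp_rw [h2] at hA
  rcases isEmpty_or_nonempty (Fin n) with he | ⟨⟨k⟩⟩
  · simp
  simp_rw [fun i => aux_diag i k] at hA
  rw [← Finset.mul_sum] at hA
  exact (mul_eq_zero.1 hA).resolve_left (aux_diag_pos k).ne'

open Pointwise in
theorem aux_scale {n : ℕ} (g : EuclideanSpace ℝ (Fin n) → ℝ)
    (x : EuclideanSpace ℝ (Fin n)) (h : ℝ) (hh : 0 < h) :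
    (1 / (volume (closedBall x h)).toReal) * ∫ t in closedBall x h, g t =
    (1 / (volume (closedBall (0 : EuclideanSpace ℝ (Fin n)) 1)).toReal) *
      ∫ y in closedBall (0 : EuclideanSpace ℝ (Fin n)) 1, g (x + h • y) := by
  rw [Measure.setIntegral_comp_smul_of_pos volume (fun y => g (x + y)) _ hh]
  have h1 : h • closedBall (0 : EuclideanSpace ℝ (Fin n)) 1 = closedBall 0 h := by
    rw [_root_.smul_closedBall _ _ zero_le_one]; simp [abs_of_pos hh]
  rw [h1, Measure.addHaar_closedBall' _ _ hh.le, ENNReal.toReal_mul,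
    ENNReal.toReal_ofReal (by positivity)]
  have h2 : ∫ t in closedBall x h, g t = ∫ y in closedBall 0 h, g (x + y) := by
    have := (measurePreserving_add_left volume x).setIntegral_preimage_emb
      (measurableEmbedding_addLeft x) g (closedBall x h)
    rw [← this]; simp
  rw [h2, smul_eq_mul]
  field_simp

theorem aux_mvp {n : ℕ} (c : ℝ)
    (v : EuclideanSpace ℝ (Fin n))
    (g : EuclideanSpace ℝ (Fin n) → ℝ) (hg : ContDiff ℝ 1 g) (V : ℝ) (hV : V ≠ 0)
    (H : ∀ x : EuclideanSpace ℝ (Fin n), ∀ h : ℝ, 0 < h → V * g (x + (c * h) • v) =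
      ∫ y in closedBall (0 : EuclideanSpace ℝ (Fin n)) 1, g (x + h • y))
    (H0 : ∀ x, V * g x = ∫ y in closedBall (0 : EuclideanSpace ℝ (Fin n)) 1, g (x + (0:ℝ) • y)) :
    ∀ x : EuclideanSpace ℝ (Fin n), ∀ h : ℝ, 0 < h → V * g x =
      ∫ y in closedBall (0 : EuclideanSpace ℝ (Fin n)) 1, g (x + h • y) := by
  have hd : Differentiable ℝ g := hg.differentiable (by norm_num)
  have key : ∀ x, c * fderiv ℝ g x v = 0 := by
    intro x
    have h1 := (aux_deriv g hg x 0).hasDerivWithinAt (s := Set.Ici 0)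
    simp only [zero_smul, add_zero, aux_odd] at h1
    have h2 : HasDerivAt (fun h : ℝ => V * g (x + (c * h) • v)) (V * fderiv ℝ g x (c • v)) 0 := by
      have h3 : HasDerivAt (fun r : ℝ => x + (c * r) • v) (c • v) 0 := by
        simpa using (((hasDerivAt_id (0:ℝ)).const_mul c).smul_const v).const_add x
      have h4 : HasFDerivAt g (fderiv ℝ g x) (x + (c * 0) • v) := by
        simpa using (hd x).hasFDerivAt
      exact (h4.comp_hasDerivAt (0:ℝ) h3).const_mul V
    have h5 : HasDerivWithinAt (fun h : ℝ => V * g (x + (c * h) • v)) 0 (Set.Ici 0) 0 := by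
      refine h1.congr (fun r hr => ?_) ?_
      · rcases (Set.mem_Ici.1 hr).eq_or_lt with rfl | hr
        · simpa using H0 x
        · exact H x r hr
      · simpa using H0 x
    have h6 := (uniqueDiffOn_Ici (0:ℝ) 0 Set.self_mem_Ici).eq_deriv _ h2.hasDerivWithinAt h5
    simpa [hV] using h6
  intro x h hh
  rw [← H x h hh]
  rcases eq_or_ne c 0 with rfl | hc
  · simp
  have hD : ∀ s : ℝ, HasDerivAt (fun s : ℝ => g (x + s • v)) 0 s := by
    intro s
    have h3 : HasDerivAt (fun r : ℝ => x + r • v) v s := by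
      simpa using ((hasDerivAt_id s).smul_const v).const_add x
    have := (hd (x + s • v)).hasFDerivAt.comp_hasDerivAt s h3
    rwa [(mul_eq_zero.1 (key (x + s • v))).resolve_left hc] at this
  have := is_const_of_deriv_eq_zero (fun s => (hD s).differentiableAt) (fun s => (hD s).deriv)
    (c * h) 0
  simp at this
  rw [this]

theorem aux_lap {n : ℕ} 
    (g : EuclideanSpace ℝ (Fin n) → ℝ) (hg : ContDiff ℝ 2 g) (V : ℝ)
    (H : ∀ x : EuclideanSpace ℝ (Fin n), ∀ h : ℝ, 0 < h → V * g x =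
      ∫ y in closedBall (0 : EuclideanSpace ℝ (Fin n)) 1, g (x + h • y))
    (x : EuclideanSpace ℝ (Fin n)) :
    ∑ i, fderiv ℝ (fderiv ℝ g) x (EuclideanSpace.single i 1) (EuclideanSpace.single i 1) = 0 := by
  have hg1 : ContDiff ℝ 1 g := hg.of_le (by norm_num)
  have hc : Continuous (fderiv ℝ g) := hg.continuous_fderiv (by norm_num)
  have hd : DifferentiableAt ℝ (fderiv ℝ g) x :=
    (hg.fderiv_right (m := 1) (by norm_num)).differentiable (by norm_num) x
  apply aux_trace
  set A := fderiv ℝ (fderiv ℝ g) x with hA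
  have hAd : HasFDerivAt (fderiv ℝ g) A x := hd.hasFDerivAt
  have hz : ∀ h : ℝ, 0 < h →
      ∫ y in closedBall (0 : EuclideanSpace ℝ (Fin n)) 1, fderiv ℝ g (x + h • y) y = 0 := by
    intro h hh
    have h1 := aux_deriv g hg1 x h
    have h2 : HasDerivAt (fun h : ℝ => ∫ y in closedBall (0 : EuclideanSpace ℝ (Fin n)) 1,
        g (x + h • y)) 0 h := by
      refine (hasDerivAt_const h (V * g x)).congr_of_eventuallyEq ?_
      filter_upwards [lt_mem_nhds hh] with r hr
      exact (H x r hr).symm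
    exact h1.unique h2
  set W := (volume (closedBall (0 : EuclideanSpace ℝ (Fin n)) 1)).toReal with hW
  have hW0 : 0 ≤ W := ENNReal.toReal_nonneg
  have hb : ∀ ε : ℝ, 0 < ε →
      ‖∫ y in closedBall (0 : EuclideanSpace ℝ (Fin n)) 1, A y y‖ ≤ ε * W := by
    intro ε hε
    have := hAd.isLittleO.def hε
    obtain ⟨δ, hδ, hb⟩ := Metric.eventually_nhds_iff_ball.1 this
    have hh : 0 < δ / 2 := by positivity
    set h := δ / 2 with hhd
    have h1 : ∫ y in closedBall (0 : EuclideanSpace ℝ (Fin n)) 1,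
        (fderiv ℝ g (x + h • y) y - fderiv ℝ g x y - h * A y y) =
        - (h * ∫ y in closedBall (0 : EuclideanSpace ℝ (Fin n)) 1, A y y) := by
      rw [integral_sub (aux_int (by fun_prop) 1) (aux_int (by fun_prop) 1),
        integral_sub (aux_int (by fun_prop) 1) (aux_int (by fun_prop) 1),
        hz h hh, aux_odd, integral_const_mul]
      ring
    have h2 : ‖∫ y in closedBall (0 : EuclideanSpace ℝ (Fin n)) 1,
        (fderiv ℝ g (x + h • y) y - fderiv ℝ g x y - h * A y y)‖ ≤ (ε * h) * W := by
      refine norm_setIntegral_le_of_norm_le_const measure_closedBall_lt_top fun y hy => ?_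
      simp only [mem_closedBall, dist_zero_right] at hy
      have hn : ‖h • y‖ ≤ h := by
        rw [norm_smul, Real.norm_eq_abs, abs_of_pos hh]
        nlinarith
      have h3 := hb (x + h • y) (by
        simp only [mem_ball, dist_self_add_left]
        linarith)
      rw [add_sub_cancel_left] at h3
      have h4 : fderiv ℝ g (x + h • y) y - fderiv ℝ g x y - h * A y y =
        (fderiv ℝ g (x + h • y) - fderiv ℝ g x - A (h • y)) y := by
        simp
      rw [h4]
      refine (ContinuousLinearMap.le_opNorm _ _).trans ?_
      calc _ ≤ (ε * ‖h • y‖) * 1 := by gcongr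
        _ ≤ ε * h := by rw [mul_one]; gcongr
    rw [h1, norm_neg, norm_mul, Real.norm_eq_abs h, abs_of_pos hh] at h2
    have : h * ‖∫ y in closedBall (0 : EuclideanSpace ℝ (Fin n)) 1, A y y‖ ≤ h * (ε * W) := by
      linarith
    exact le_of_mul_le_mul_left this hh
  have h0 : ‖∫ y in closedBall (0 : EuclideanSpace ℝ (Fin n)) 1, A y y‖ ≤ 0 := by
    refine le_of_forall_pos_le_add fun ε hε => ?_
    have := hb (ε / (W + 1)) (by positivity)
    refine this.trans ?_
    rw [zero_add, div_mul_eq_mul_div, div_le_iff₀ (by positivity)]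
    nlinarith
  exact norm_le_zero_iff.1 h0

theorem aux_layer {n : ℕ} (F : EuclideanSpace ℝ (Fin n) → ℝ) (hF : Continuous F)
    (H : ∀ r : ℝ, 0 < r → ∫ y in closedBall (0 : EuclideanSpace ℝ (Fin n)) r, F y = 0)
    (G : ℝ → ℝ) (hG : ContDiff ℝ 1 G) (hG1 : ∀ t, 1 ≤ t → G t = 0) :
    ∫ y, G (‖y‖ ^ 2) * F y = 0 := by
  have hG' : Continuous (deriv G) := hG.continuous_deriv (by norm_num)
  have e1 : ∫ y, G (‖y‖ ^ 2) * F y =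
      ∫ y in closedBall (0 : EuclideanSpace ℝ (Fin n)) 1, G (‖y‖ ^ 2) * F y := by
    refine (setIntegral_eq_integral_of_forall_compl_eq_zero fun y hy => ?_).symm
    simp only [mem_closedBall, dist_zero_right, not_le] at hy
    rw [hG1 _ (by nlinarith), zero_mul]
  set K : EuclideanSpace ℝ (Fin n) → ℝ → ℝ := fun y s =>
    Set.indicator {p : EuclideanSpace ℝ (Fin n) × ℝ | ‖p.1‖ ^ 2 < p.2}
      (fun p => F p.1 * deriv G p.2) (y, s) with hK
  have e2 : ∀ y ∈ closedBall (0 : EuclideanSpace ℝ (Fin n)) 1,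
      G (‖y‖ ^ 2) * F y = - ∫ s in Set.Ioc (0:ℝ) 1, K y s := by
    intro y hy
    simp only [mem_closedBall, dist_zero_right] at hy
    have hy2 : ‖y‖ ^ 2 ≤ 1 := by nlinarith [norm_nonneg y]
    have : ∀ s, K y s = (Set.Ioi (‖y‖ ^ 2)).indicator (fun s => F y * deriv G s) s := by
      intro s
      simp [hK, Set.indicator]
    simp_rw [this]
    rw [setIntegral_indicator measurableSet_Ioi]
    have hs : Set.Ioc (0:ℝ) 1 ∩ Set.Ioi (‖y‖ ^ 2) = Set.Ioc (‖y‖ ^ 2) 1 := by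
      rw [Set.Ioc_inter_Ioi, sup_of_le_right (by positivity)]
    rw [hs, integral_const_mul, ← intervalIntegral.integral_of_le hy2,
      intervalIntegral.integral_deriv_eq_sub (fun t _ => hG.differentiable (by norm_num) t)
        (hG'.intervalIntegrable _ _), hG1 1 le_rfl]
    ring
  rw [e1, setIntegral_congr_fun measurableSet_closedBall e2, integral_neg, neg_eq_zero]
  rw [integral_integral_swap]
  · refine (setIntegral_congr_fun measurableSet_Ioc fun s hs => ?_).trans (integral_zero _ _)
    have hs0 : 0 < √s := Real.sqrt_pos.2 hs.1
    have hs1 : √s ≤ 1 := Real.sqrt_le_one.2 hs.2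
    have : ∀ y, K y s = (ball (0 : EuclideanSpace ℝ (Fin n)) (√s)).indicator
        (fun y => F y * deriv G s) y := by
      intro y
      simp [hK, Set.indicator, Real.lt_sqrt]
    simp only [this]
    rw [setIntegral_indicator measurableSet_ball, Set.inter_eq_right.2
      (ball_subset_closedBall.trans (closedBall_subset_closedBall hs1)), integral_mul_const]
    have hae : ball (0 : EuclideanSpace ℝ (Fin n)) (√s) =ᵐ[volume] closedBall 0 (√s) := by
      refine ae_eq_of_subset_of_measure_ge ball_subset_closedBall ?_
        measurableSet_ball.nullMeasurableSet measure_closedBall_lt_top.ne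
      rw [Measure.addHaar_closedBall _ _ hs0.le, Measure.addHaar_ball_of_pos _ _ hs0]
    rw [setIntegral_congr_set hae, H _ hs0, zero_mul]
  · have : Integrable (fun p : EuclideanSpace ℝ (Fin n) × ℝ => F p.1 * deriv G p.2)
        ((volume.restrict (closedBall 0 1)).prod (volume.restrict (Set.Ioc 0 1))) :=
      Integrable.mul_prod (aux_int hF 1)
        ((hG'.integrableOn_Icc).mono_set Set.Ioc_subset_Icc_self)
    refine this.indicator (measurableSet_lt (by fun_prop) (by fun_prop))

theorem aux_smooth {n : ℕ}
    (g : EuclideanSpace ℝ (Fin n) → ℝ) (hg : Continuous g)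
    (H : ∀ x : EuclideanSpace ℝ (Fin n), ∀ h : ℝ, 0 < h →
      g x = (1 / (volume (closedBall x h)).toReal) * ∫ t in closedBall x h, g t) :
    ContDiff ℝ 2 g := by
  set G : ℝ → ℝ := fun t => Real.smoothTransition (1 - t) with hGdef
  have hG : ∀ m : ℕ∞, ContDiff ℝ m G := fun m =>
    Real.smoothTransition.contDiff.comp (contDiff_const.sub contDiff_id)
  have hG1 : ∀ t, 1 ≤ t → G t = 0 := fun t ht =>
    Real.smoothTransition.zero_of_nonpos (by linarith)
  set φ : EuclideanSpace ℝ (Fin n) → ℝ := fun y => G (‖y‖ ^ 2) with hφ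
  have hφs : ContDiff ℝ (2 : ℕ∞) φ := (hG 2).comp (contDiff_norm_sq ℝ)
  have hφ0 : ∀ y, y ∉ closedBall (0 : EuclideanSpace ℝ (Fin n)) 1 → φ y = 0 := by
    intro y hy
    simp only [mem_closedBall, dist_zero_right, not_le] at hy
    exact hG1 _ (by nlinarith)
  have hφc : HasCompactSupport φ := HasCompactSupport.intro (isCompact_closedBall _ _) hφ0
  have hmean : ∀ x, ∫ y, φ y * (g (x - y) - g x) = 0 := by
    intro x
    refine aux_layer (fun y => g (x - y) - g x) (by fun_prop) (fun r hr => ?_) G (hG 1) hG1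
    have hv : 0 < (volume (closedBall x r)).toReal :=
      ENNReal.toReal_pos (measure_closedBall_pos _ _ hr).ne' measure_closedBall_lt_top.ne
    have h2 : ∫ t in closedBall x r, g t = ∫ y in closedBall 0 r, g (x - y) := by
      have := (Measure.measurePreserving_sub_left volume x).setIntegral_preimage_emb
        (Homeomorph.subLeft x).measurableEmbedding g (closedBall x r)
      rw [← this]; congr 2; ext y; simp
    rw [integral_sub (aux_int (by fun_prop) r) (aux_int (by fun_prop) r), ← h2, setIntegral_const,
      smul_eq_mul, measureReal_def, ← Measure.addHaar_closedBall_center volume x r]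
    have := H x r hr
    field_simp at this
    linarith
  have hI : 0 < ∫ y, φ y := by
    refine (hφs.continuous.integral_pos_of_hasCompactSupport_nonneg_nonzero hφc
      (fun y => Real.smoothTransition.nonneg _) (x := 0) ?_)
    simp [hφ, hGdef]
  have hconv : ContDiff ℝ (2 : ℕ∞) (convolution φ g (ContinuousLinearMap.lsmul ℝ ℝ) volume) :=
    hφc.contDiff_convolution_left _ hφs hg.locallyIntegrable
  have heq : g = fun x => (∫ y, φ y)⁻¹ * convolution φ g (ContinuousLinearMap.lsmul ℝ ℝ) volume x := by
    funext x
    rw [eq_inv_mul_iff_mul_eq₀ hI.ne', convolution_def]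
    have h1 := hmean x
    simp_rw [mul_sub] at h1
    have hφcont := hφs.continuous
    rw [integral_sub, integral_mul_const] at h1
    · simp only [ContinuousLinearMap.lsmul_apply, smul_eq_mul]
      linarith
    · exact Continuous.integrable_of_hasCompactSupport (by fun_prop) hφc.mul_right
    · exact Continuous.integrable_of_hasCompactSupport (by fun_prop) hφc.mul_right
  rw [heq]
  exact contDiff_const.mul hconv

theorem weighted_mean_value_property_implies_harmonic
    (n : ℕ) (lam : ℝ) (hlam : lam ∈ Set.Ioo (0 : ℝ) 1)
    (v : EuclideanSpace ℝ (Fin n)) (hv : ‖v‖ = 1)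
    (g : EuclideanSpace ℝ (Fin n) → ℝ) (hg : ContDiff ℝ 1 g)
    (hmvp : ∀ x : EuclideanSpace ℝ (Fin n), ∀ h : ℝ, 0 < h →
      g (x + ((1 - 2 * lam) * h) • v)
        = (1 / (volume (closedBall x h)).toReal) * ∫ t in closedBall x h, g t) :
    ContDiff ℝ 2 g ∧ ∀ x : EuclideanSpace ℝ (Fin n),
      ∑ i : Fin n, iteratedFDeriv ℝ 2 g x
        ![EuclideanSpace.single i (1 : ℝ), EuclideanSpace.single i (1 : ℝ)] = 0 := by
  set V := (volume (closedBall (0 : EuclideanSpace ℝ (Fin n)) 1)).toReal with hVd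
  have hV : 0 < V :=
    ENNReal.toReal_pos (measure_closedBall_pos _ _ one_pos).ne' measure_closedBall_lt_top.ne
  have H := aux_mvp (1 - 2 * lam) v g hg V hV.ne' (fun x h hh => by
      rw [hmvp x h hh, aux_scale g x h hh, ← hVd]
      field_simp) (fun x => by simp [measureReal_def, hVd])
  have h2 : ContDiff ℝ 2 g := aux_smooth g hg.continuous fun x h hh => by
    rw [aux_scale g x h hh, ← H x h hh, ← hVd]
    field_simp
  refine ⟨h2, fun x => ?_⟩
  simp only [iteratedFDeriv_two_apply]
  exact aux_lap g h2 V H x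
end

section
/- Fix λ ∈ (0,1) with λ ≠ 1/2, a unit vector v ∈ ℝⁿ, and let g : ℝⁿ → ℝ be continuously differentiable. Suppose that for all x ∈ ℝⁿ and all h > 0, g(x + (1-2λ)h·v) = (1/|B_h(x)|) ∫_{B_h(x)} g(t) dV. Then g is constant in the v-direction: the directional derivative of g along v vanishes at every point, i.e., ∇g(x)·v = 0 for all x. -/
open MeasureTheory Metric

theorem aux_symm_integral {n : ℕ} (L : EuclideanSpace ℝ (Fin n) →L[ℝ] ℝ)
    (x : EuclideanSpace ℝ (Fin n)) (h : ℝ) :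
    ∫ t in closedBall x h, L (t - x) = 0 := by
  rw [← integral_indicator measurableSet_closedBall]
  have h1 := integral_sub_left_eq_self
    ((closedBall x h).indicator (fun t => L (t - x))) volume (x + x)
  have h2 : ∀ t, (closedBall x h).indicator (fun t => L (t - x)) (x + x - t)
      = - (closedBall x h).indicator (fun t => L (t - x)) t := by
    intro t
    have e : x + x - t - x = -(t - x) := by abel
    have hm : (x + x - t ∈ closedBall x h) ↔ t ∈ closedBall x h := by
      rw [mem_closedBall, mem_closedBall, dist_eq_norm, dist_eq_norm, e, norm_neg]
    by_cases ht : t ∈ closedBall x h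
    · rw [Set.indicator_of_mem (hm.2 ht), Set.indicator_of_mem ht, e, map_neg]
    · rw [Set.indicator_of_notMem (fun q => ht (hm.1 q)), Set.indicator_of_notMem ht, neg_zero]
  simp_rw [h2] at h1
  rw [integral_neg] at h1
  linarith

theorem weighted_mean_value_property_directional_deriv_zero
    (n : ℕ) (lam : ℝ) (hlam : lam ∈ Set.Ioo (0 : ℝ) 1) (hlam' : lam ≠ 1 / 2)
    (v : EuclideanSpace ℝ (Fin n)) (hv : ‖v‖ = 1)
    (g : EuclideanSpace ℝ (Fin n) → ℝ) (hg : ContDiff ℝ 1 g)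
    (hmvp : ∀ x : EuclideanSpace ℝ (Fin n), ∀ h : ℝ, 0 < h →
      g (x + ((1 - 2 * lam) * h) • v)
        = (1 / (volume (closedBall x h)).toReal) * ∫ t in closedBall x h, g t) :
    ∀ x : EuclideanSpace ℝ (Fin n), fderiv ℝ g x v = 0 := by
  intro x
  obtain ⟨hl0, hl1⟩ := hlam
  set L := fderiv ℝ g x with hL
  have hd : HasFDerivAt g L x := (hg.differentiable (by norm_num) x).hasFDerivAt
  set c : ℝ := 1 - 2 * lam with hc
  have hc0 : c ≠ 0 := by
    intro h0; apply hlam'; linarith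
  have hc1 : |c| ≤ 1 := by rw [abs_le]; constructor <;> linarith
  have key : ∀ ε : ℝ, 0 < ε → |c * L v| ≤ 2 * ε := by
    intro ε hε
    have hb := (hasFDerivAt_iff_isLittleO.1 hd).def hε
    obtain ⟨δ, hδ, hb⟩ := Metric.eventually_nhds_iff.1 hb
    set h := δ / 2 with hh
    have hpos : 0 < h := by positivity
    have hbd : ∀ t ∈ closedBall x h, ‖g t - g x - L (t - x)‖ ≤ ε * h := by
      intro t ht
      rw [mem_closedBall] at ht
      have h1 := hb (y := t) (by linarith)
      rw [dist_eq_norm] at ht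
      exact h1.trans (by gcongr)
    have hV : 0 < (volume (closedBall x h)).toReal :=
      ENNReal.toReal_pos (measure_closedBall_pos volume x hpos).ne'
        measure_closedBall_lt_top.ne
    have hI := norm_setIntegral_le_of_norm_le_const (μ := volume)
      (measure_closedBall_lt_top (x := x) (r := h)) hbd
    have ig : IntegrableOn g (closedBall x h) volume :=
      hg.continuous.continuousOn.integrableOn_compact (isCompact_closedBall x h)
    have ic : IntegrableOn (fun _ => g x) (closedBall x h) volume :=
      continuousOn_const.integrableOn_compact (isCompact_closedBall x h)
    have iL : IntegrableOn (fun t => L (t - x)) (closedBall x h) volume :=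
      (by fun_prop : Continuous (fun t => L (t - x))).continuousOn.integrableOn_compact
        (isCompact_closedBall x h)
    have igc : IntegrableOn (fun t => g t - g x) (closedBall x h) volume := ig.sub ic
    rw [integral_sub igc iL, integral_sub ig ic, aux_symm_integral,
      setIntegral_const, sub_zero, smul_eq_mul] at hI
    have hm := hmvp x h hpos
    have hp := hbd (x + (c * h) • v) (by
      rw [mem_closedBall, dist_eq_norm, add_sub_cancel_left, norm_smul, hv, mul_one,
        Real.norm_eq_abs, abs_mul, abs_of_pos hpos]
      nlinarith)
    rw [add_sub_cancel_left, map_smul, smul_eq_mul] at hp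
    simp only [Measure.real] at hI
    set V := (volume (closedBall x h)).toReal
    set J := ∫ t in closedBall x h, g t
    have hJ : J = V * g (x + (c * h) • v) := by
      rw [hm]; field_simp
    rw [hJ, ← mul_sub, Real.norm_eq_abs, abs_mul, abs_of_pos hV, mul_comm (ε * h) V] at hI
    have hI' := le_of_mul_le_mul_left hI hV
    rw [Real.norm_eq_abs] at hp
    have h3 : |c * L v| * h ≤ 2 * ε * h := by
      have : |c * L v| * h = |c * h * L v| := by
        rw [← abs_of_pos hpos, ← abs_mul, abs_of_pos hpos]; congr 1; ring
      rw [this]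
      rw [abs_le] at *
      constructor <;> linarith [hp.1, hp.2, hI'.1, hI'.2]
    exact le_of_mul_le_mul_right h3 hpos
  by_contra hne
  have hp : 0 < |c * L v| := abs_pos.2 (mul_ne_zero hc0 hne)
  have := key (|c * L v| / 4) (by positivity)
  linarith
end

section
/- Fix λ ∈ (0,1), a unit vector v ∈ ℝⁿ, and let g : ℝⁿ → ℝ be continuously differentiable. Suppose that for all x ∈ ℝⁿ and all h > 0, g(x + (1-2λ)h·v) = (1/|B_h(x)|) ∫_{B_h(x)} g(t) dV. Then g is infinitely differentiable (of class C^∞) on ℝⁿ. -/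
open MeasureTheory Metric

noncomputable def wmGauge {n : ℕ} (c : ℝ) (v z : EuclideanSpace ℝ (Fin n)) : ℝ :=
  (-(c * inner ℝ z v) + Real.sqrt ((c * inner ℝ z v)^2 + (1 - c^2) * ‖z‖^2)) / (1 - c^2)

lemma wmGauge_le {n : ℕ} (c : ℝ) (hc : 0 < 1 - c^2) (v z : EuclideanSpace ℝ (Fin n))
    (hv : ‖v‖ = 1) (h : ℝ) (hh : 0 < h) : wmGauge c v z ≤ h ↔ ‖z - (c * h) • v‖ ≤ h := by
  have e : ‖z - (c * h) • v‖^2 = ‖z‖^2 - 2 * (c * h * inner ℝ z v) + (c*h)^2 := by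
    rw [norm_sub_sq_real, inner_smul_right, norm_smul, hv, mul_one, Real.norm_eq_abs, sq_abs]
  rw [← sq_le_sq₀ (norm_nonneg _) hh.le, e, wmGauge, div_le_iff₀ hc]
  generalize inner ℝ z v = a
  have hN : 0 ≤ (1 - c^2) * ‖z‖^2 := by positivity
  have key : ‖z‖^2 - 2 * (c * h * a) + (c*h)^2 ≤ h^2 ↔
      (c*a)^2 + (1 - c^2) * ‖z‖^2 ≤ (h * (1 - c^2) + c * a)^2 := by
    have : (h * (1 - c^2) + c * a)^2 - ((c*a)^2 + (1 - c^2) * ‖z‖^2)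
      = (1 - c^2) * (h^2 - (‖z‖^2 - 2 * (c * h * a) + (c*h)^2)) := by ring
    rw [← sub_nonneg, ← sub_nonneg (b := (c*a)^2 + (1 - c^2) * ‖z‖^2), this]
    exact (mul_nonneg_iff_of_pos_left hc).symm
  rw [key]
  have hp : 0 < h * (1 - c^2) := by positivity
  constructor
  · intro H
    exact (Real.sqrt_le_left (by have := Real.sqrt_nonneg ((c*a)^2 + (1 - c^2) * ‖z‖^2); linarith)).1
      (by linarith)
  · intro H
    have h2 := Real.sqrt_le_sqrt H
    rw [Real.sqrt_sq_eq_abs] at h2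
    rcases abs_cases (h * (1 - c^2) + c * a) with ⟨h3, _⟩ | ⟨h3, h4⟩
    · linarith
    · exfalso
      have : (h * (1 - c^2) + c * a)^2 < (c * a)^2 := by nlinarith
      linarith

lemma wmGauge_cont {n : ℕ} (c : ℝ) (v : EuclideanSpace ℝ (Fin n)) :
    Continuous (wmGauge c v) := by
  unfold wmGauge
  fun_prop

lemma wmGauge_smooth {n : ℕ} (c : ℝ) (hc : 0 < 1 - c^2) (v z : EuclideanSpace ℝ (Fin n))
    (hz : z ≠ 0) : ContDiffAt ℝ (⊤ : ℕ∞) (wmGauge c v) z := by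
  unfold wmGauge
  have h0 : ContDiffAt ℝ (⊤ : ℕ∞) (fun z : EuclideanSpace ℝ (Fin n) => c * inner ℝ z v) z :=
    contDiffAt_const.mul (contDiffAt_id.inner ℝ contDiffAt_const)
  have h1 : ContDiffAt ℝ (⊤ : ℕ∞) (fun z : EuclideanSpace ℝ (Fin n) => ‖z‖^2) z :=
    (contDiff_norm_sq ℝ).contDiffAt
  have hpos : 0 < ‖z‖ := norm_pos_iff.2 hz
  refine ContDiffAt.div_const (h0.neg.add (ContDiffAt.sqrt ?_ ?_)) _
  · exact (h0.pow 2).add (contDiffAt_const.mul h1)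
  · positivity

noncomputable def wmBump : ContDiffBump (2 : ℝ) := ⟨1/2, 1, by norm_num, by norm_num⟩

noncomputable def wmTail (s : ℝ) : ℝ := ∫ h in Set.Ici s, wmBump h

lemma wmBump_supp {h : ℝ} (hh : wmBump h ≠ 0) : 1 < h ∧ h < 3 := by
  have : h ∈ Function.support wmBump := hh
  rw [ContDiffBump.support_eq] at this
  have h2 : |h - 2| < 1 := by simpa [wmBump, Real.dist_eq] using this
  rw [abs_lt] at h2
  constructor <;> linarith

lemma wmTail_smooth : ContDiff ℝ (⊤ : ℕ∞) wmTail := by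
  have hi : Integrable (fun h => wmBump h) := wmBump.integrable
  have hcont : Continuous (fun h => wmBump h) := wmBump.continuous
  have e : wmTail = fun s => (∫ h, wmBump h) - (∫ h in Set.Iic 0, wmBump h)
      - ∫ h in (0:ℝ)..s, wmBump h := by
    funext s
    rw [← intervalIntegral.integral_Iic_sub_Iic hi.integrableOn hi.integrableOn, wmTail,
      integral_Ici_eq_integral_Ioi, ← intervalIntegral.integral_Iic_add_Ioi (b := s) hi.integrableOn hi.integrableOn]
    ring
  rw [e]
  refine contDiff_const.sub ?_
  have hd : ∀ s, HasDerivAt (fun s => ∫ h in (0:ℝ)..s, wmBump h) (wmBump s) s := fun s =>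
    intervalIntegral.integral_hasDerivAt_right (hcont.intervalIntegrable _ _)
      (hcont.stronglyMeasurableAtFilter _ _) hcont.continuousAt
  rw [contDiff_infty_iff_deriv]
  refine ⟨fun s => (hd s).differentiableAt, ?_⟩
  have : deriv (fun s => ∫ h in (0:ℝ)..s, wmBump h) = wmBump := funext fun s => (hd s).deriv
  rw [this]
  exact wmBump.contDiff

lemma wmTail_le {s : ℝ} (hs : s ≤ 1) : wmTail s = ∫ h, wmBump h := by
  refine setIntegral_eq_integral_of_forall_compl_eq_zero fun x hx => ?_
  by_contra h
  exact hx (hs.trans (wmBump_supp h).1.le)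

lemma wmTail_ge {s : ℝ} (hs : 3 ≤ s) : wmTail s = 0 := by
  refine setIntegral_eq_zero_of_forall_eq_zero fun x hx => ?_
  by_contra h
  exact absurd (wmBump_supp h).2 (not_lt.2 (hs.trans hx))

lemma wmKer_smooth {n : ℕ} (c : ℝ) (hc : 0 < 1 - c^2) (v : EuclideanSpace ℝ (Fin n)) :
    ContDiff ℝ (⊤ : ℕ∞) (fun z => wmTail (wmGauge c v z)) := by
  rw [contDiff_iff_contDiffAt]
  intro z
  by_cases hz : z = 0
  · have h0 : wmGauge c v z < 1 := by simp [hz, wmGauge]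
    have : (fun z => wmTail (wmGauge c v z)) =ᶠ[nhds z] fun _ => ∫ h, wmBump h := by
      filter_upwards [(wmGauge_cont c v).continuousAt.eventually (gt_mem_nhds h0)] with y hy
      exact wmTail_le (le_of_lt hy)
    exact contDiffAt_const.congr_of_eventuallyEq this
  · exact wmTail_smooth.contDiffAt.comp z (wmGauge_smooth c hc v z hz)

lemma wmKer_supp {n : ℕ} (c : ℝ) (hc : 0 < 1 - c^2) (v : EuclideanSpace ℝ (Fin n))
    (hv : ‖v‖ = 1) : HasCompactSupport (fun z => wmTail (wmGauge c v z)) := by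
  refine HasCompactSupport.intro (isCompact_closedBall ((c * 3) • v) 3) fun z hz => wmTail_ge ?_
  by_contra h
  exact hz (by rw [mem_closedBall, dist_eq_norm]; exact (wmGauge_le c hc v z hv 3 (by norm_num)).1 (not_le.1 h).le)

theorem weighted_mean_value_property_implies_smooth_Rn
    (n : ℕ) (lam : ℝ) (hlam : lam ∈ Set.Ioo (0 : ℝ) 1)
    (v : EuclideanSpace ℝ (Fin n)) (hv : ‖v‖ = 1)
    (g : EuclideanSpace ℝ (Fin n) → ℝ) (hg : ContDiff ℝ 1 g)
    (hmvp : ∀ x : EuclideanSpace ℝ (Fin n), ∀ h : ℝ, 0 < h →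
      g (x + ((1 - 2 * lam) * h) • v)
        = (1 / (volume (closedBall x h)).toReal) * ∫ t in closedBall x h, g t) :
    ContDiff ℝ (⊤ : ℕ∞) g := by
  obtain ⟨h0, h1⟩ := hlam
  generalize hcdef : 1 - 2 * lam = c at hmvp
  have hc : 0 < 1 - c^2 := by rw [← hcdef]; nlinarith
  clear hcdef
  have hgc := hg.continuous
  set V : ℝ := (volume (closedBall (0 : EuclideanSpace ℝ (Fin n)) 1)).toReal with hV
  have hVpos : 0 < V := ENNReal.toReal_pos (measure_closedBall_pos _ _ one_pos).ne'
    measure_closedBall_lt_top.ne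
  have hvol : ∀ (x : EuclideanSpace ℝ (Fin n)) (h : ℝ), 0 < h →
      (volume (closedBall x h)).toReal = h^n * V := by
    intro x h hh
    rw [Measure.addHaar_closedBall' _ _ hh.le, ENNReal.toReal_mul, ENNReal.toReal_ofReal (by positivity)]
    simp [hV]
  have hm : ∀ y h, 0 < h → ∫ t in closedBall (y - (c*h) • v) h, g t = h^n * V * g y := by
    intro y h hh
    have := hmvp (y - (c*h) • v) h hh
    rw [sub_add_cancel, hvol _ _ hh] at this
    rw [this]
    have : h^n * V ≠ 0 := by positivity
    field_simp
  set C : ℝ := ∫ h, wmBump h * (h^n * V) with hC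
  have hCpos : 0 < C := by
    refine Continuous.integral_pos_of_hasCompactSupport_nonneg_nonzero (x := 2)
      (wmBump.continuous.mul (by fun_prop)) wmBump.hasCompactSupport.mul_right ?_ ?_
    · intro h
      by_cases hh : wmBump h = 0
      · simp [hh]
      · have := (wmBump_supp hh).1
        have := wmBump.nonneg (x := h)
        simp only [Pi.zero_apply]
        positivity
    · have : wmBump 2 = 1 := wmBump.one_of_mem_closedBall (by simp [wmBump])
      simp [this, hVpos.ne']
  have main : ∀ y, C * g y = ∫ t, wmTail (wmGauge c v (y - t)) * g t := by
    intro y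
    let S : Set (ℝ × EuclideanSpace ℝ (Fin n)) := {q | wmGauge c v (y - q.2) ≤ q.1}
    have hS : MeasurableSet S := by
      refine IsClosed.measurableSet (isClosed_le ?_ continuous_fst)
      exact (wmGauge_cont c v).comp (by fun_prop)
    let F : ℝ → EuclideanSpace ℝ (Fin n) → ℝ := fun h t =>
      if wmGauge c v (y - t) ≤ h then wmBump h * g t else 0
    let B := closedBall (y - (c * 3) • v) 3
    have hF : Integrable (Function.uncurry F) (volume.prod volume) := by
      have hB : Integrable (B.indicator g) :=
        (hgc.continuousOn.integrableOn_compact (isCompact_closedBall _ _)).integrable_indicator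
          measurableSet_closedBall
      have h1 := ((wmBump.integrable (μ := volume)).mul_prod hB).indicator hS
      refine h1.congr (Filter.Eventually.of_forall fun q => ?_)
      obtain ⟨h, t⟩ := q
      by_cases hq : wmGauge c v (y - t) ≤ h
      · have : (h, t) ∈ S := hq
        simp only [Set.indicator_of_mem this, Function.uncurry, F, if_pos hq]
        by_cases hb : wmBump h = 0
        · simp [hb]
        · have : t ∈ B := by
            have := (wmGauge_le c hc v (y - t) hv 3 (by norm_num)).1 (hq.trans (wmBump_supp hb).2.le)
            rw [mem_closedBall, dist_comm, dist_eq_norm, sub_right_comm]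
            exact this
          rw [Set.indicator_of_mem this]
      · have : (h, t) ∉ S := hq
        simp only [Set.indicator_of_notMem this, Function.uncurry, F, if_neg hq]
    have hsw := integral_integral_swap hF
    have hL : ∀ h, ∫ t, F h t = wmBump h * (h^n * V) * g y := by
      intro h
      by_cases hb : wmBump h = 0
      · simp [F, hb]
      have hh : 0 < h := by linarith [(wmBump_supp hb).1]
      rw [mul_assoc, ← hm y h hh, ← integral_indicator measurableSet_closedBall, ← integral_const_mul]
      congr 1
      funext t
      have : wmGauge c v (y - t) ≤ h ↔ t ∈ closedBall (y - (c*h) • v) h := by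
        rw [wmGauge_le c hc v _ hv h hh, mem_closedBall, dist_comm, dist_eq_norm]
        rw [sub_right_comm]
      by_cases ht : wmGauge c v (y - t) ≤ h
      · simp only [F]
        rw [if_pos ht, Set.indicator_of_mem (this.1 ht)]
      · simp only [F]
        rw [if_neg ht, Set.indicator_of_notMem (fun h' => ht (this.2 h')), mul_zero]
    have hR : ∀ t, ∫ h, F h t = wmTail (wmGauge c v (y - t)) * g t := by
      intro t
      rw [wmTail, ← integral_indicator measurableSet_Ici, ← integral_mul_const]
      congr 1
      funext h
      simp only [F, Set.indicator_apply, Set.mem_Ici]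
      split_ifs <;> simp
    simp only [hL, hR] at hsw
    rw [integral_mul_const] at hsw
    exact hsw
  have hconv := (wmKer_supp c hc v hv).contDiff_convolution_left (ContinuousLinearMap.lsmul ℝ ℝ)
    (μ := volume) (wmKer_smooth c hc v) hgc.locallyIntegrable
  have : g = fun y => C⁻¹ * (convolution (fun z => wmTail (wmGauge c v z)) g
      (ContinuousLinearMap.lsmul ℝ ℝ) volume) y := by
    funext y
    rw [convolution_lsmul_swap]
    simp only [smul_eq_mul]
    rw [← main y]
    field_simp
  rw [this]
  exact contDiff_const.mul hconv
end

section
/- Fix λ ∈ (0,1) with λ ≠ 1/2, a unit vector v ∈ ℝⁿ, and let g : ℝⁿ → ℝ be continuously differentiable. Suppose that for all x ∈ ℝⁿ and all h > 0, g(x + (1-2λ)h·v) = (1/|B_h(x)|) ∫_{B_h(x)} g(t) dV. Then g satisfies the ordinary (unweighted) mean value property: for all x ∈ ℝⁿ and all h > 0, g(x) = (1/|B_h(x)|) ∫_{B_h(x)} g(t) dV. -/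
open MeasureTheory Metric

lemma odd_int {n : ℕ} (D : EuclideanSpace ℝ (Fin n) →L[ℝ] ℝ) (x : EuclideanSpace ℝ (Fin n))
    (h : ℝ) : ∫ t in closedBall x h, D (t - x) = 0 := by
  rw [← integral_indicator isClosed_closedBall.measurableSet]
  have h1 := integral_sub_left_eq_self
    ((closedBall x h).indicator (fun t => D (t - x))) volume (x + x)
  have h2 : ∀ t, (closedBall x h).indicator (fun t => D (t - x)) (x + x - t)
      = - (closedBall x h).indicator (fun t => D (t - x)) t := by
    intro t
    have e : x + x - t - x = -(t - x) := by abel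
    have hm : (x + x - t ∈ closedBall x h) ↔ t ∈ closedBall x h := by
      rw [mem_closedBall, mem_closedBall, dist_eq_norm, dist_eq_norm, e, norm_neg]
    by_cases ht : t ∈ closedBall x h
    · rw [Set.indicator_of_mem ht, Set.indicator_of_mem (hm.2 ht), e, map_neg]
    · rw [Set.indicator_of_notMem ht, Set.indicator_of_notMem (fun q => ht (hm.1 q)), neg_zero]
  simp_rw [h2] at h1
  rw [integral_neg] at h1
  linarith

theorem weighted_mean_value_property_implies_unweighted
    (n : ℕ) (lam : ℝ) (hlam : lam ∈ Set.Ioo (0 : ℝ) 1) (hlam' : lam ≠ 1 / 2)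
    (v : EuclideanSpace ℝ (Fin n)) (hv : ‖v‖ = 1)
    (g : EuclideanSpace ℝ (Fin n) → ℝ) (hg : ContDiff ℝ 1 g)
    (hmvp : ∀ x : EuclideanSpace ℝ (Fin n), ∀ h : ℝ, 0 < h →
      g (x + ((1 - 2 * lam) * h) • v)
        = (1 / (volume (closedBall x h)).toReal) * ∫ t in closedBall x h, g t) :
    ∀ x : EuclideanSpace ℝ (Fin n), ∀ h : ℝ, 0 < h →
      g x = (1 / (volume (closedBall x h)).toReal) * ∫ t in closedBall x h, g t := by
  have hdiff : Differentiable ℝ g := hg.differentiable (by norm_num)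
  obtain ⟨c, hc⟩ : ∃ c, c = 1 - 2 * lam := ⟨_, rfl⟩
  rw [← hc] at hmvp
  have hc0 : c ≠ 0 := by
    intro h0; apply hlam'; linarith
  have hc1 : |c| ≤ 1 := by
    rw [abs_le]; constructor <;> linarith [hlam.1, hlam.2]
  have key : ∀ x, fderiv ℝ g x v = 0 := by
    intro x
    set D := fderiv ℝ g x with hD
    have hle : ∀ ε > 0, |c| * |D v| ≤ 2 * ε := by
      intro ε hε
      have hlo := (hasFDerivAt_iff_isLittleO.1 (hdiff x).hasFDerivAt).def hε
      obtain ⟨δ, hδ, hb⟩ := Metric.eventually_nhds_iff.1 hlo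
      obtain ⟨h, hh, hhδ⟩ := exists_between hδ
      have hb' : ∀ t ∈ closedBall x h, ‖g t - g x - D (t - x)‖ ≤ ε * h := by
        intro t ht
        have ht' := mem_closedBall.1 ht
        refine (hb (lt_of_le_of_lt ht' hhδ)).trans ?_
        rw [← dist_eq_norm]
        gcongr
      have hfin : volume (closedBall x h) < ⊤ := measure_closedBall_lt_top
      have hV : 0 < (volume (closedBall x h)).toReal :=
        ENNReal.toReal_pos (measure_closedBall_pos volume x hh).ne' hfin.ne
      have hI := norm_setIntegral_le_of_norm_le_const hfin hb'
      have hcomp := isCompact_closedBall x h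
      have i1 : IntegrableOn g (closedBall x h) volume :=
        hg.continuous.continuousOn.integrableOn_compact hcomp
      have i2 : IntegrableOn (fun _ => g x) (closedBall x h) volume :=
        continuous_const.continuousOn.integrableOn_compact hcomp
      have i3 : IntegrableOn (fun t => D (t - x)) (closedBall x h) volume :=
        (by fun_prop : Continuous fun t => D (t - x)).continuousOn.integrableOn_compact hcomp
      have e : ∫ t in closedBall x h, (g t - g x - D (t - x))
          = (∫ t in closedBall x h, g t) - (volume (closedBall x h)).toReal * g x := by
        have i12 : IntegrableOn (fun t => g t - g x) (closedBall x h) volume := i1.sub i2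
        rw [integral_sub i12 i3, integral_sub i1 i2, odd_int, setIntegral_const]
        simp [Measure.real]
      rw [e] at hI
      have m := hmvp x h hh
      set V := (volume (closedBall x h)).toReal with hVdef
      have m' : (∫ t in closedBall x h, g t) = V * g (x + (c * h) • v) := by
        rw [m]; field_simp
      rw [m', ← mul_sub, norm_mul, Real.norm_of_nonneg hV.le, Measure.real, ← hVdef,
        mul_comm, Real.norm_eq_abs] at hI
      have hI' := le_of_mul_le_mul_right hI hV
      have hmem : x + (c * h) • v ∈ closedBall x h := by
        rw [mem_closedBall, dist_eq_norm, add_sub_cancel_left, norm_smul, hv, mul_one,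
          Real.norm_eq_abs, abs_mul, abs_of_pos hh]
        nlinarith
      have h3 := hb' _ hmem
      rw [add_sub_cancel_left, map_smul, Real.norm_eq_abs, smul_eq_mul] at h3
      have h4 : |c * h * D v| ≤ 2 * ε * h := by
        rw [abs_le] at *
        constructor <;> linarith [hI'.1, hI'.2, h3.1, h3.2]
      rw [abs_mul, abs_mul, abs_of_pos hh] at h4
      have : (|c| * |D v|) * h ≤ 2 * ε * h := by linarith
      exact le_of_mul_le_mul_right this hh
    have hz : |c| * |D v| ≤ 0 := by
      apply le_of_forall_pos_le_add
      intro ε hε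
      have := hle (ε / 2) (by positivity)
      linarith
    have hcp := abs_pos.2 hc0
    by_contra hne
    have := mul_pos hcp (abs_pos.2 hne)
    linarith
  intro x h hh
  rw [← hmvp x h hh]
  have hd : ∀ s : ℝ, HasDerivAt (fun s : ℝ => g (x + s • v)) 0 s := by
    intro s
    have h1 : HasDerivAt (fun s : ℝ => x + s • v) v s := by
      simpa using ((hasDerivAt_id s).smul_const v).const_add x
    have h2 := (hdiff (x + s • v)).hasFDerivAt.comp_hasDerivAt s h1
    rw [key] at h2
    exact h2
  have := is_const_of_deriv_eq_zero (fun s => (hd s).differentiableAt) (fun s => (hd s).deriv)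
    0 (c * h)
  simpa using this
end

section
/- Fix λ ∈ (0,1) with λ ≠ 1/2 and let g : ℝ² → ℝ be continuously differentiable. Suppose that for all x ∈ ℝ² and all h > 0, g(x + (1-2λ)h·v) = (1/|B_h(x)|) ∫_{B_h(x)} g(t) dV, where v = (0,1). Then there exist real constants a and b such that g(x, y) = a·x + b for all (x, y) ∈ ℝ². -/
open MeasureTheory Metric

lemma aux_lin (L : EuclideanSpace ℝ (Fin 2) →L[ℝ] ℝ) (x : EuclideanSpace ℝ (Fin 2)) (h : ℝ) :
    ∫ t in closedBall x h, L (t - x) = 0 := by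
  have h1 : ∫ t in closedBall x h, L (t - x) = - ∫ t in closedBall x h, L (t - x) := by
    rw [← integral_indicator isClosed_closedBall.measurableSet]
    conv_lhs => rw [← integral_sub_left_eq_self _ volume (x + x)]
    rw [← integral_neg]
    congr 1
    ext t
    have e : x + x - t - x = -(t - x) := by abel
    have : (x + x - t ∈ closedBall x h) ↔ t ∈ closedBall x h := by
      rw [mem_closedBall, mem_closedBall, dist_eq_norm, dist_eq_norm, e, norm_neg]
    by_cases ht : t ∈ closedBall x h
    · rw [Set.indicator_of_mem (this.2 ht), Set.indicator_of_mem ht, e, map_neg]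
    · rw [Set.indicator_of_notMem (fun h => ht (this.1 h)), Set.indicator_of_notMem ht, neg_zero]
  linarith

lemma aux_int_s13 {G : EuclideanSpace ℝ (Fin 2) → ℝ} (hG : Continuous G)
    (x : EuclideanSpace ℝ (Fin 2)) (h : ℝ) : IntegrableOn G (closedBall x h) :=
  hG.continuousOn.integrableOn_compact (isCompact_closedBall x h)

lemma aux_max (G : EuclideanSpace ℝ (Fin 2) → ℝ) (hG : Continuous G)
    (hm : ∀ x h, 0 < h → ∫ t in closedBall x h, (G x - G t) = 0)
    (F : ℝ → ℝ) (hF : Continuous F) (hGF : ∀ t, G t = F (t 0)) (p q : ℝ)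
    (hp : F p ≤ 0) (hq : F q ≤ 0) (s : ℝ) (hs : s ∈ Set.Icc p q) : F s ≤ 0 := by
  obtain ⟨x0, hx0, hmax⟩ := isCompact_Icc.exists_isMaxOn ⟨s, hs⟩ hF.continuousOn
  have hmax' : ∀ y ∈ Set.Icc p q, F y ≤ F x0 := fun y hy => hmax hy
  refine (hmax' s hs).trans ?_
  by_contra! hM
  have hxp : p < x0 := lt_of_le_of_ne hx0.1 (by rintro rfl; linarith)
  have hxq : x0 < q := lt_of_le_of_ne hx0.2 (by rintro rfl; linarith)
  set X : EuclideanSpace ℝ (Fin 2) := EuclideanSpace.single 0 x0 with hX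
  have hX0 : X 0 = x0 := by simp [hX]
  have key : ∀ h, 0 < h → h ≤ x0 - p → h ≤ q - x0 → ∀ t ∈ closedBall X h, G t = F x0 := by
    intro h hh h1 h2
    have hnn : ∀ t ∈ closedBall X h, 0 ≤ G X - G t := by
      intro t ht
      rw [hGF, hGF, hX0]
      have : |t 0 - x0| ≤ h := by
        have h3 := PiLp.norm_apply_le (t - X) 0
        rw [mem_closedBall, dist_eq_norm] at ht
        rw [PiLp.sub_apply, hX0, Real.norm_eq_abs] at h3
        exact h3.trans ht
      rw [abs_le] at this
      linarith [hmax' (t 0) ⟨by linarith, by linarith⟩]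
    have hc : Continuous fun t => G X - G t := by fun_prop
    have h0 := hm X h hh
    rw [setIntegral_eq_zero_iff_of_nonneg_ae
      ((ae_restrict_iff' isClosed_closedBall.measurableSet).2 (Filter.Eventually.of_forall hnn))
      (aux_int_s13 hc X h)] at h0
    have := Measure.eqOn_of_ae_eq h0 hc.continuousOn continuousOn_const (by
      rw [interior_closedBall _ hh.ne', closure_ball _ hh.ne'])
    intro t ht
    have h5 := this ht
    simp only [Pi.zero_apply] at h5
    rw [hGF X, hX0] at h5
    linarith
  have mem : ∀ (h : ℝ) (e : ℝ), |e| ≤ h → X + EuclideanSpace.single 0 e ∈ closedBall X h := by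
    intro h e he
    rw [mem_closedBall, dist_eq_norm]
    simpa using he
  have ev : ∀ e : ℝ, G (X + EuclideanSpace.single 0 e) = F (x0 + e) := by
    intro e
    rw [hGF, PiLp.add_apply, hX0]
    simp
  rcases le_total (x0 - p) (q - x0) with hle | hle
  · have := key (x0 - p) (by linarith) le_rfl hle _ (mem _ (p - x0) (by
      rw [abs_sub_comm, abs_of_pos (by linarith)]))
    rw [ev, add_sub_cancel] at this
    linarith
  · have := key (q - x0) (by linarith) hle le_rfl _ (mem _ (q - x0) (by
      rw [abs_of_pos (by linarith)]))
    rw [ev, add_sub_cancel] at this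
    linarith

lemma aux_fderiv (c : ℝ) (hc : c ≠ 0)
    (g : EuclideanSpace ℝ (Fin 2) → ℝ) (hg : ContDiff ℝ 1 g)
    (v : EuclideanSpace ℝ (Fin 2)) (hv : ‖v‖ = 1)
    (hm : ∀ x h, 0 < h → ∫ t in closedBall x h, (g t - g (x + (c * h) • v)) = 0)
    (x : EuclideanSpace ℝ (Fin 2)) : fderiv ℝ g x v = 0 := by
  set D := fderiv ℝ g x with hD
  have hd : HasFDerivAt g D x := (hg.differentiable (by norm_num) x).hasFDerivAt
  have key : ∀ ε > 0, |c * D v| ≤ ε * (1 + |c|) := by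
    intro ε hε
    have h1 := hd.isLittleO.def hε
    obtain ⟨δ, hδ, h2⟩ := Metric.eventually_nhds_iff.1 h1
    set h := δ / (2 * (1 + |c|)) with hh
    have hc1 : 0 < 1 + |c| := by positivity
    have hpos : 0 < h := by positivity
    have hle : h * (1 + |c|) < δ := by rw [hh]; field_simp; linarith
    have hch : 0 ≤ h * |c| := by positivity
    have b1 := h2 (y := x + (c * h) • v) (by
      simp only [dist_eq_norm, add_sub_cancel_left, norm_smul, hv, Real.norm_eq_abs, abs_mul,
        abs_of_pos hpos]; nlinarith)
    simp only [add_sub_cancel_left, norm_smul, hv, Real.norm_eq_abs, abs_mul,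
        abs_of_pos hpos, map_smul, smul_eq_mul, mul_one] at b1
    have hcont := hg.continuous
    set V := volume.real (closedBall x h) with hV
    have hVpos : 0 < V := by
      apply ENNReal.toReal_pos (measure_closedBall_pos _ _ hpos).ne'
      exact measure_closedBall_lt_top.ne
    have b2 : ‖∫ t in closedBall x h, (g t - g x - D (t - x))‖ ≤ ε * h * V := by
      apply norm_setIntegral_le_of_norm_le_const measure_closedBall_lt_top
      intro t ht
      rw [mem_closedBall] at ht
      refine (h2 (y := t) (by nlinarith)).trans ?_
      rw [← dist_eq_norm]
      gcongr
    have b3 : ∫ t in closedBall x h, (g t - g x - D (t - x))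
        = V * (g (x + (c * h) • v) - g x) := by
      have e : (fun t => g t - g x - D (t - x)) = fun t =>
          ((g t - g (x + (c * h) • v)) + (g (x + (c * h) • v) - g x)) - D (t - x) := by
        ext t; ring
      rw [e, integral_sub, integral_add, hm x h hpos, aux_lin]
      · simp [hV]
      all_goals exact aux_int_s13 (by fun_prop) x h
    rw [b3, norm_mul, Real.norm_eq_abs, Real.norm_eq_abs, abs_of_pos hVpos] at b2
    have b4 : |g (x + (c * h) • v) - g x| ≤ ε * h := by
      rw [mul_comm] at b2
      exact le_of_mul_le_mul_right b2 hVpos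
    have b5 : |c * D v| * h ≤ (ε * (1 + |c|)) * h := by
      rw [← abs_of_pos hpos, ← abs_mul, abs_of_pos hpos]
      rw [abs_le] at b1 b4 ⊢
      constructor <;> nlinarith
    exact le_of_mul_le_mul_right b5 hpos
  have h0 : |c * D v| ≤ 0 := by
    apply le_of_forall_pos_le_add
    intro ε hε
    have := key (ε / (1 + |c|)) (by positivity)
    rw [div_mul_cancel₀ _ (by positivity)] at this
    linarith
  have := abs_nonpos_iff.1 h0
  exact (mul_eq_zero.1 this).resolve_left hc

theorem weighted_mean_value_property_plane
    (lam : ℝ) (hlam : lam ∈ Set.Ioo (0 : ℝ) 1) (hlam' : lam ≠ 1 / 2)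
    (g : EuclideanSpace ℝ (Fin 2) → ℝ) (hg : ContDiff ℝ 1 g)
    (hmvp : ∀ x : EuclideanSpace ℝ (Fin 2), ∀ h : ℝ, 0 < h →
      g (x + ((1 - 2 * lam) * h) • EuclideanSpace.single (1 : Fin 2) (1 : ℝ))
        = (1 / (volume (closedBall x h)).toReal) * ∫ t in closedBall x h, g t) :
    ∃ a b : ℝ, ∀ p : EuclideanSpace ℝ (Fin 2), g p = a * p 0 + b := by
  have hcont := hg.continuous
  set v : EuclideanSpace ℝ (Fin 2) := EuclideanSpace.single (1 : Fin 2) (1 : ℝ) with hv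
  have hm : ∀ x h, 0 < h →
      ∫ t in closedBall x h, (g t - g (x + ((1 - 2 * lam) * h) • v)) = 0 := by
    intro x h hh
    have hVpos : 0 < (volume (closedBall x h)).toReal :=
      ENNReal.toReal_pos (measure_closedBall_pos _ _ hh).ne' measure_closedBall_lt_top.ne
    rw [integral_sub (aux_int_s13 hcont x h) (aux_int_s13 continuous_const x h), setIntegral_const,
      hmvp x h hh, smul_eq_mul, Measure.real]
    field_simp
    ring
  have hD := aux_fderiv (1 - 2 * lam) (fun h => hlam' (by linarith)) g hg v (by simp [hv]) hm
  have hinv : ∀ p (s : ℝ), g (p + s • v) = g p := by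
    intro p s
    have hder : ∀ s : ℝ, HasDerivAt (fun s : ℝ => g (p + s • v)) 0 s := by
      intro s
      have h1 : HasDerivAt (fun s : ℝ => p + s • v) v s := by
        simpa using ((hasDerivAt_id s).smul_const v).const_add p
      have h2 := ((hg.differentiable (by norm_num) (p + s • v)).hasFDerivAt).comp_hasDerivAt s h1
      rw [hD] at h2
      exact h2
    have := is_const_of_deriv_eq_zero (fun s => (hder s).differentiableAt)
      (fun s => (hder s).deriv) s 0
    simpa using this
  set F : ℝ → ℝ := fun s => g (EuclideanSpace.single 0 s) with hFdef
  have hF : Continuous F := by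
    apply hcont.comp
    have : (fun s : ℝ => (EuclideanSpace.single 0 s : EuclideanSpace ℝ (Fin 2)))
        = fun s : ℝ => s • EuclideanSpace.single 0 (1 : ℝ) := by
      ext s i; simp
    change Continuous (fun s : ℝ => (EuclideanSpace.single 0 s : EuclideanSpace ℝ (Fin 2)))
    rw [this]
    fun_prop
  have hgF : ∀ t, g t = F (t 0) := by
    intro t
    refine Eq.trans ?_ (hinv (EuclideanSpace.single 0 (t 0)) (t 1))
    congr 1
    ext i
    fin_cases i <;> simp [hv]
  have haff : ∀ α β σ : ℝ, ∀ x h, 0 < h →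
      ∫ t in closedBall x h, (σ * (g x - (α * x 0 + β)) - σ * (g t - (α * t 0 + β))) = 0 := by
    intro α β σ x h hh
    have e : (fun t : EuclideanSpace ℝ (Fin 2) =>
        (σ * (g x - (α * x 0 + β)) - σ * (g t - (α * t 0 + β)))) = fun t =>
        (σ * α) * (EuclideanSpace.proj (𝕜 := ℝ) (0 : Fin 2) : EuclideanSpace ℝ (Fin 2) →L[ℝ] ℝ) (t - x)
        - σ * (g t - g (x + ((1 - 2 * lam) * h) • v)) := by
      ext t
      rw [hinv]
      simp
      ring
    rw [e, integral_sub, integral_const_mul, integral_const_mul, hm x h hh, aux_lin]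
    · simp
    all_goals exact aux_int_s13 (by fun_prop) x h
  have hchord : ∀ R > 0, ∃ α β : ℝ, ∀ s ∈ Set.Icc (-R) R, F s = α * s + β := by
    intro R hR
    set α := (F R - F (-R)) / (2 * R) with hα
    set β := (F R + F (-R)) / 2 with hβ
    have e1 : F R - (α * R + β) = 0 := by rw [hα, hβ]; field_simp; ring
    have e2 : F (-R) - (α * (-R) + β) = 0 := by rw [hα, hβ]; field_simp; ring
    refine ⟨α, β, fun s hs => ?_⟩
    have H : ∀ σ : ℝ, σ * (F s - (α * s + β)) ≤ 0 := fun σ =>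
      aux_max (fun t => σ * (g t - (α * t 0 + β))) (by fun_prop) (haff α β σ)
        (fun s => σ * (F s - (α * s + β))) (by fun_prop) (fun t => by simp only [hgF t])
        (-R) R (by simp only [e2, mul_zero, le_refl]) (by simp only [e1, mul_zero, le_refl]) s hs
    linarith [H 1, H (-1)]
  refine ⟨F 1 - F 0, F 0, fun p => ?_⟩
  rw [hgF]
  generalize p 0 = s
  obtain ⟨α, β, h⟩ := hchord (|s| + 1) (by positivity)
  have ha := abs_nonneg s
  rw [h s ⟨by linarith [neg_abs_le s], by linarith [le_abs_self s]⟩,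
    h 1 ⟨by linarith, by linarith⟩, h 0 ⟨by linarith, by linarith⟩]
  ring
end
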